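/- (Moser-type product and commutator estimates.) Let α be a multi-index with |α| = k ≥ 1 and let 1 < p < ∞. Then there exists a constant C > 0 such that for all Schwartz functions f, g on ℝ³ and all exponents 1 ≤ p₁, p₂, p₃, p₄ ≤ ∞ with 1/p = 1/p₁ + 1/p₂ = 1/p₃ + 1/p₄ one has: (i) ‖D^α(fg)‖_{L^p} ≤ C(‖f‖_{L^{p₁}} ‖∇^k g‖_{L^{p₂}} + ‖∇^k f‖_{L^{p₃}} ‖g‖_{L^{p₄}}), and (ii) ‖[D^α, f]g‖_{L^p} ≤ C(‖∇f‖_{L^{p₁}} ‖∇^{k−1} g‖_{L^{p₂}} + ‖∇^k f‖_{L^{p₃}} ‖g‖_{L^{p₄}}), where [D^α, f]g := D^α(fg) − f D^α g. -/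

import Mathlib

open MeasureTheory Real Set ENNReal NNReal

noncomputable section

abbrev V3 := Fin 3 → ℝ

def e3 (i : Fin 3) : V3 := Pi.single i 1

/-- The mixed partial derivative `D^α f` of order `|α| = k`, where the multi-index `α`
is recorded as the word `d : Fin k → Fin 3` listing (with multiplicity) the coordinate
directions of differentiation. -/
def Dmix (k : ℕ) (d : Fin k → Fin 3) (f : V3 → ℝ) : V3 → ℝ :=
  fun x => iteratedFDeriv ℝ k f x (fun i => e3 (d i))

/-! ### The Hardy-Littlewood maximal function -/

/-- average over a closed cube -/
def avg (h : V3 → ℝ≥0∞) (c : V3) (r : ℝ) : ℝ≥0∞ :=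
  (∫⁻ y in Metric.closedBall c r, h y) / volume (Metric.closedBall c r)

/-- uncentered maximal function -/
def MM (h : V3 → ℝ≥0∞) (x : V3) : ℝ≥0∞ :=
  ⨆ c : V3, ⨆ r : ℝ, ⨆ _ : 0 < r, (Metric.ball c r).indicator (fun _ => avg h c r) x

lemma MM_lsc (h : V3 → ℝ≥0∞) : LowerSemicontinuous (MM h) := by
  unfold MM
  refine lowerSemicontinuous_iSup fun c => lowerSemicontinuous_iSup fun r =>
    lowerSemicontinuous_iSup fun _ => ?_
  exact Metric.isOpen_ball.lowerSemicontinuous_indicator zero_le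

lemma vol_cb_ne_zero (c : V3) {r : ℝ} (hr : 0 < r) : volume (Metric.closedBall c r) ≠ 0 :=
  (Metric.measure_closedBall_pos _ _ hr).ne'

lemma vol_cb_ne_top (c : V3) (r : ℝ) : volume (Metric.closedBall c r) ≠ ⊤ :=
  measure_closedBall_lt_top.ne

lemma vol_cb_four (c : V3) {r : ℝ} (hr : 0 < r) :
    volume (Metric.closedBall c (4 * r)) = 64 * volume (Metric.closedBall c r) := by
  rw [Real.volume_pi_closedBall _ (by positivity), Real.volume_pi_closedBall _ hr.le]
  rw [show (64 : ℝ≥0∞) = ENNReal.ofReal 64 by simp, ← ENNReal.ofReal_mul (by norm_num)]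
  congr 1
  simp
  ring

lemma lt_MM_iff (h : V3 → ℝ≥0∞) (x : V3) (l : ℝ≥0∞) :
    l < MM h x ↔ ∃ c r, 0 < r ∧ x ∈ Metric.ball c r ∧ l < avg h c r := by
  unfold MM
  simp only [lt_iSup_iff]
  constructor
  · rintro ⟨c, r, hr, hl⟩
    refine ⟨c, r, hr, ?_⟩
    by_cases hx : x ∈ Metric.ball c r
    · rw [indicator_of_mem hx] at hl
      exact ⟨hx, hl⟩
    · rw [indicator_of_notMem hx] at hl
      simp at hl
  · rintro ⟨c, r, hr, hx, hl⟩
    exact ⟨c, r, hr, by rwa [indicator_of_mem hx]⟩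

lemma weak_MM (h : V3 → ℝ≥0∞) (hfin : ∫⁻ y, h y ≠ ⊤) (l : ℝ≥0∞) (hl0 : l ≠ 0) (hlt : l ≠ ⊤) :
    l * volume {x | l < MM h x} ≤ 64 * ∫⁻ y, h y := by
  set t : Set (V3 × ℝ) := {a | 0 < a.2 ∧
    l * volume (Metric.closedBall a.1 a.2) < ∫⁻ y in Metric.closedBall a.1 a.2, h y} with ht
  have hR : ∀ a ∈ t, a.2 ≤ max 1 ((∫⁻ y, h y) / l).toReal := by
    rintro ⟨c, r⟩ ⟨hr, ha⟩
    dsimp only at hr ha ⊢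
    have h1 : volume (Metric.closedBall c r) ≤ (∫⁻ y, h y) / l := by
      rw [ENNReal.le_div_iff_mul_le (Or.inl hl0) (Or.inl hlt), mul_comm]
      exact ha.le.trans (setLIntegral_le_lintegral _ _)
    rw [Real.volume_pi_closedBall _ hr.le, ENNReal.ofReal_le_iff_le_toReal] at h1
    · by_cases h2 : r ≤ 1
      · exact le_max_of_le_left h2
      · refine le_max_of_le_right (le_trans ?_ h1)
        push Not at h2
        simp only [Fintype.card_fin]
        nlinarith [sq_nonneg r, mul_pos hr hr, mul_pos (mul_pos hr hr) hr]
    · exact (ENNReal.div_lt_top hfin hl0).ne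
  obtain ⟨u, hut, hdisj, hcov⟩ := Vitali.exists_disjoint_subfamily_covering_enlargement_closedBall
    t Prod.fst Prod.snd _ hR 4 (by norm_num)
  have hcount : u.Countable := by
    refine hdisj.countable_of_nonempty_interior fun a ha => ?_
    refine ⟨a.1, ?_⟩
    exact Metric.ball_subset_interior_closedBall (Metric.mem_ball_self (hut ha).1)
  have hsub : {x | l < MM h x} ⊆ ⋃ a ∈ u, Metric.closedBall a.1 (4 * a.2) := by
    intro x hx
    obtain ⟨c, r, hr, hxr, hlr⟩ := (lt_MM_iff h x l).1 hx
    have : (c, r) ∈ t := by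
      refine ⟨hr, ?_⟩
      unfold avg at hlr
      rwa [ENNReal.lt_div_iff_mul_lt (Or.inl (vol_cb_ne_zero c hr))
        (Or.inl (vol_cb_ne_top c r))] at hlr
    obtain ⟨b, hb, hbs⟩ := hcov _ this
    exact mem_biUnion hb (hbs (Metric.ball_subset_closedBall hxr))
  calc l * volume {x | l < MM h x}
      ≤ l * volume (⋃ a ∈ u, Metric.closedBall a.1 (4 * a.2)) := by gcongr
    _ ≤ l * ∑' a : u, volume (Metric.closedBall a.1.1 (4 * a.1.2)) := by
        gcongr; exact measure_biUnion_le _ hcount _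
    _ = ∑' a : u, 64 * (l * volume (Metric.closedBall a.1.1 a.1.2)) := by
        rw [← ENNReal.tsum_mul_left]
        congr 1; ext a
        rw [vol_cb_four _ (hut a.2).1]; ring
    _ ≤ ∑' a : u, 64 * (∫⁻ y in Metric.closedBall a.1.1 a.1.2, h y) := by
        refine ENNReal.tsum_le_tsum fun a => ?_
        gcongr
        exact (hut a.2).2.le
    _ = 64 * ∫⁻ y in ⋃ a ∈ u, Metric.closedBall a.1 a.2, h y := by
        rw [ENNReal.tsum_mul_left, lintegral_biUnion hcount (fun _ _ => Metric.isClosed_closedBall.measurableSet) hdisj]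
    _ ≤ _ := mul_le_mul_right (setLIntegral_le_lintegral _ _) _

lemma MM_trunc (h : V3 → ℝ≥0∞) (l : ℝ≥0∞) (x : V3) (hx : 2 * l < MM h x) :
    l < MM (({y | l < h y}).indicator h) x := by
  obtain ⟨c, r, hr, hxr, hlr⟩ := (lt_MM_iff h x _).1 hx
  refine (lt_MM_iff _ x l).2 ⟨c, r, hr, hxr, ?_⟩
  by_contra hcon
  push Not at hcon
  refine absurd hlr (not_lt.2 ?_)
  have h1 : ∀ y, h y ≤ l + ({y | l < h y}).indicator h y := by
    intro y
    by_cases hy : l < h y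
    · rw [indicator_of_mem (by exact hy)]; exact le_add_self
    · rw [indicator_of_notMem (by exact hy)]; simpa using hy
  have h2 : ∫⁻ y in Metric.closedBall c r, h y ≤ l * volume (Metric.closedBall c r) +
      ∫⁻ y in Metric.closedBall c r, ({y | l < h y}).indicator h y := by
    refine (lintegral_mono h1).trans ?_
    rw [lintegral_add_left measurable_const]
    simp
  calc avg h c r ≤ (l * volume (Metric.closedBall c r) +
      ∫⁻ y in Metric.closedBall c r, ({y | l < h y}).indicator h y) /
        volume (Metric.closedBall c r) := by unfold avg; gcongr
    _ = l + avg (({y | l < h y}).indicator h) c r := by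
        rw [ENNReal.add_div, mul_div_assoc, ENNReal.div_self (vol_cb_ne_zero c hr)
        (vol_cb_ne_top c r), mul_one, avg]
    _ ≤ l + l := by gcongr
    _ = 2 * l := by ring

lemma MM_le_of_ae (h : V3 → ℝ≥0∞) (B : ℝ≥0∞) (hB : ∀ᵐ y, h y ≤ B) (x : V3) : MM h x ≤ B := by
  refine iSup_le fun c => iSup_le fun r => iSup_le fun hr => ?_
  classical
  rw [indicator_apply]
  split_ifs
  swap
  · exact zero_le
  unfold avg
  refine ENNReal.div_le_of_le_mul ?_
  refine (lintegral_mono_ae (ae_restrict_of_ae hB)).trans ?_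
  simp

/-- strong-type estimate from truncated weak-type estimate -/
lemma strong_of_weak (G h : V3 → ℝ) (hGm : Measurable G) (hhm : Measurable h) (hG : ∀ x, 0 ≤ G x)
    (hh : ∀ x, 0 ≤ h x)
    (hw : ∀ t : ℝ, 0 < t → ENNReal.ofReal t * volume {x | 2 * t < G x} ≤
      64 * ∫⁻ y in {y | t < h y}, ENNReal.ofReal (h y)) (q : ℝ) (hq : 1 < q) :
    ∫⁻ x, ENNReal.ofReal ((G x / 2) ^ q) ≤
      64 * ENNReal.ofReal (q / (q - 1)) * ∫⁻ x, ENNReal.ofReal (h x ^ q) := by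
  have hq1 : 0 < q - 1 := by linarith
  rw [lintegral_rpow_eq_lintegral_meas_lt_mul volume
    (Filter.Eventually.of_forall fun x => by have := hG x; simp; positivity)
    (hGm.div_const 2).aemeasurable (by linarith : 0 < q)]
  set μ : Measure V3 := volume.withDensity (fun x => ENNReal.ofReal (h x)) with hμ
  have e1 : ∫⁻ x, ENNReal.ofReal (h x ^ q) = ∫⁻ x, ENNReal.ofReal (h x ^ (q - 1)) ∂μ := by
    rw [hμ, lintegral_withDensity_eq_lintegral_mul _ (by fun_prop) (by fun_prop)]
    refine lintegral_congr fun x => ?_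
    simp only [Pi.mul_apply]
    rw [← ENNReal.ofReal_mul (hh x)]
    congr 1
    rcases (hh x).eq_or_lt with h0 | h0
    · rw [← h0, Real.zero_rpow (by linarith), Real.zero_rpow (by linarith), mul_zero]
    · rw [Real.rpow_sub_one h0.ne']; field_simp
  have e2 := lintegral_rpow_eq_lintegral_meas_lt_mul μ (f := h)
    (Filter.Eventually.of_forall fun x => hh x) hhm.aemeasurable hq1
  rw [e1, e2, ENNReal.ofReal_div_of_pos hq1]
  have e3 : ∀ X : ℝ≥0∞, 64 * (ENNReal.ofReal q / ENNReal.ofReal (q - 1)) *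
      (ENNReal.ofReal (q - 1) * X) = ENNReal.ofReal q * (64 * X) := by
    intro X
    rw [div_eq_mul_inv]
    have : (ENNReal.ofReal (q - 1))⁻¹ * ENNReal.ofReal (q - 1) = 1 :=
      ENNReal.inv_mul_cancel (by simpa using hq1) ENNReal.ofReal_ne_top
    calc _ = ENNReal.ofReal q * (64 * X) * ((ENNReal.ofReal (q - 1))⁻¹ * ENNReal.ofReal (q - 1)) := by ring
      _ = _ := by rw [this, mul_one]
  rw [e3]
  gcongr
  rw [← lintegral_const_mul' _ _ (by simp)]
  refine setLIntegral_mono' measurableSet_Ioi fun t ht => ?_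
  have ht' : (0:ℝ) < t := ht
  have e4 : ENNReal.ofReal (t ^ (q - 1)) = ENNReal.ofReal t * ENNReal.ofReal (t ^ (q - 1 - 1)) := by
    rw [← ENNReal.ofReal_mul ht'.le]
    congr 1
    rw [Real.rpow_sub_one ht'.ne' (q - 1)]; field_simp
  have e5 : {a | t < G a / 2} = {x | 2 * t < G x} := by
    ext x; simp only [mem_ofPred_eq]; constructor <;> intro h <;> linarith
  rw [e4, e5, ← mul_assoc, ← mul_assoc]
  refine mul_le_mul_left ?_ _
  rw [mul_comm, hμ, withDensity_apply _ (measurableSet_lt measurable_const hhm)]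
  exact hw t ht'

lemma setIntegral_dilate (h : V3 → ℝ) (x : V3) (s : ℝ) (hs : s ≠ 0) :
    ∫ y in Metric.closedBall (0 : V3) 1, h (x + s • y) =
      (|s| ^ 3)⁻¹ * ∫ y in Metric.closedBall x |s|, h y := by
  have h1 := Measure.setIntegral_comp_smul (volume : Measure V3) (fun y => h (x + y))
    (Metric.closedBall (0 : V3) 1) hs
  rw [h1, smul_closedBall _ _ zero_le_one]
  have h2 := (measurePreserving_add_left (volume : Measure V3) x).setIntegral_preimage_emb
    (measurableEmbedding_addLeft x) h (Metric.closedBall x |s|)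
  have h3 : (fun y => x + y) ⁻¹' Metric.closedBall x |s| = Metric.closedBall (0 : V3) |s| := by
    ext y; simp
  rw [h3] at h2
  simp [h2, abs_inv, abs_pow]

lemma maximal (p : ℝ≥0∞) (hp : 1 < p) (hp' : p ≠ ⊤) :
    ∃ C : ℝ≥0, ∀ h : V3 → ℝ, Continuous h → (∀ x, 0 ≤ h x) → (∃ B, ∀ x, h x ≤ B) → Integrable h →
      ∃ H : V3 → ℝ, Measurable H ∧ (∀ x, 0 ≤ H x) ∧
        (∀ x (s : ℝ), ∫ y in Metric.closedBall (0 : V3) 1, h (x + s • y) ≤ H x) ∧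
        ∀ q, p ≤ q → eLpNorm H q volume ≤ C * eLpNorm h q volume := by
  have hp1 : 1 < p.toReal := by
    rw [← ENNReal.toReal_one]; exact (ENNReal.toReal_lt_toReal (by simp) hp').2 hp
  set K : ℝ≥0 := 64 * (p.toReal / (p.toReal - 1)).toNNReal with hK
  have hK1 : 1 ≤ K := by
    have : (1:ℝ≥0) ≤ (p.toReal / (p.toReal - 1)).toNNReal := by
      rw [Real.one_le_toNNReal, le_div_iff₀ (by linarith)]; linarith
    calc (1:ℝ≥0) ≤ 64 * 1 := by norm_num
      _ ≤ K := by rw [hK]; gcongr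
  refine ⟨8 * (1 + 2 * K), fun h hc h0 hB hi => ?_⟩
  obtain ⟨B, hB⟩ := hB
  set h' : V3 → ℝ≥0∞ := fun x => ENNReal.ofReal (h x) with hh'
  have hMfin : ∀ x, MM h' x ≠ ⊤ := fun x => by
    refine ne_top_of_le_ne_top (ENNReal.ofReal_ne_top (r := B)) (MM_le_of_ae h' _ ?_ x)
    exact Filter.Eventually.of_forall fun y => ENNReal.ofReal_le_ofReal (hB y)
  set G : V3 → ℝ := fun x => (MM h' x).toReal with hG
  have hGm : Measurable G := (MM_lsc h').measurable.ennreal_toReal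
  have hG0 : ∀ x, 0 ≤ G x := fun x => ENNReal.toReal_nonneg
  refine ⟨fun x => 8 * (h x + G x), by fun_prop, fun x => by have := h0 x; have := hG0 x; positivity, ?_, ?_⟩
  · intro x s
    by_cases hs : s = 0
    · subst hs
      simp only [zero_smul, add_zero, setIntegral_const, smul_eq_mul]
      rw [measureReal_def, Real.volume_pi_closedBall _ zero_le_one]
      have := hG0 x
      rw [ENNReal.toReal_ofReal (by positivity)]
      simp only [Fintype.card_fin]
      nlinarith
    · have hs' : 0 < |s| := abs_pos.2 hs
      rw [setIntegral_dilate h x s hs]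
      have h1 : avg h' x |s| ≤ MM h' x := by
        by_contra hcon
        push Not at hcon
        exact lt_irrefl _ ((lt_MM_iff h' x (MM h' x)).2 ⟨x, |s|, hs', Metric.mem_ball_self hs', hcon⟩)
      have h2 : (avg h' x |s|).toReal ≤ G x := ENNReal.toReal_mono (hMfin x) h1
      rw [avg, ENNReal.toReal_div, Real.volume_pi_closedBall _ hs'.le,
        ENNReal.toReal_ofReal (by positivity)] at h2
      rw [integral_eq_lintegral_of_nonneg_ae (Filter.Eventually.of_forall h0)
        hc.aestronglyMeasurable]
      rw [div_le_iff₀ (by positivity)] at h2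
      rw [inv_mul_le_iff₀ (by positivity)]
      refine h2.trans ?_
      simp only [Fintype.card_fin]
      have : 0 ≤ |s| ^ 3 * (8 * h x) := by have := h0 x; positivity
      nlinarith
  · intro q hq
    have hq1 : 1 ≤ q := hp.le.trans hq
    have key : eLpNorm G q volume ≤ (2 * K : ℝ≥0) * eLpNorm h q volume := by
      by_cases hqt : q = ⊤
      · subst hqt
        have h1 : ∀ x, ‖G x‖ₑ ≤ eLpNorm h ⊤ volume := by
          intro x
          rw [Real.enorm_eq_ofReal (hG0 x), hG, ENNReal.ofReal_toReal (hMfin x)]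
          refine MM_le_of_ae _ _ ?_ x
          filter_upwards [enorm_ae_le_eLpNormEssSup h volume] with y hy
          rw [eLpNorm_exponent_top]
          rwa [Real.enorm_eq_ofReal (h0 y)] at hy
        have h2 : eLpNorm G ⊤ volume ≤ eLpNorm h ⊤ volume := by
          rw [eLpNorm_exponent_top (f := G)]
          exact essSup_le_of_ae_le _ (Filter.Eventually.of_forall h1)
        refine h2.trans (le_mul_of_one_le_left zero_le ?_)
        have : (1:ℝ≥0) ≤ 2 * K := by
          calc (1:ℝ≥0) ≤ 2 * 1 := by norm_num
            _ ≤ 2 * K := by gcongr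
        exact_mod_cast this
      · have hq0 : q ≠ 0 := (zero_lt_one.trans_le hq1).ne'
        have hpq : p.toReal ≤ q.toReal := ENNReal.toReal_mono hqt hq
        have hqq : 1 < q.toReal := hp1.trans_le hpq
        have hw := strong_of_weak G h hGm hc.measurable hG0 h0 ?_ q.toReal hqq
        · have hKq : 64 * ENNReal.ofReal (q.toReal / (q.toReal - 1)) ≤ (K : ℝ≥0∞) := by
            rw [hK]; push_cast
            rw [ENNReal.ofReal]
            gcongr 64 * ?_
            norm_cast
            apply Real.toNNReal_le_toNNReal
            rw [div_le_div_iff₀ (by linarith) (by linarith)]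
            nlinarith
          have conv : ∀ F : V3 → ℝ, (∀ x, 0 ≤ F x) → eLpNorm F q volume =
              (∫⁻ x, ENNReal.ofReal (F x ^ q.toReal)) ^ (1 / q.toReal) := by
            intro F hF
            rw [eLpNorm_eq_lintegral_rpow_enorm_toReal hq0 hqt]
            congr 1
            refine lintegral_congr fun x => ?_
            rw [Real.enorm_eq_ofReal (hF x), ENNReal.ofReal_rpow_of_nonneg (hF x) (by linarith)]
          have h3 : eLpNorm (fun x => G x / 2) q volume ≤ K * eLpNorm h q volume := by
            rw [conv _ (fun x => by have := hG0 x; positivity), conv h h0]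
            calc _ ≤ ((K : ℝ≥0∞) * ∫⁻ x, ENNReal.ofReal (h x ^ q.toReal)) ^ (1 / q.toReal) := by
                  gcongr
                  exact hw.trans (mul_le_mul_left hKq _)
              _ = (K : ℝ≥0∞) ^ (1 / q.toReal) * (∫⁻ x, ENNReal.ofReal (h x ^ q.toReal)) ^ (1 / q.toReal) :=
                  ENNReal.mul_rpow_of_nonneg _ _ (by positivity)
              _ ≤ _ := by
                  gcongr
                  calc (K : ℝ≥0∞) ^ (1 / q.toReal) ≤ (K : ℝ≥0∞) ^ (1:ℝ) := by
                        apply ENNReal.rpow_le_rpow_of_exponent_le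
                        · exact_mod_cast hK1
                        · rw [div_le_one (by linarith)]; linarith
                    _ = K := ENNReal.rpow_one _
          have h4 : G = (2 : ℝ) • (fun x => G x / 2) := by
            ext x; simp; ring
          rw [h4, eLpNorm_const_smul]
          have : ‖(2:ℝ)‖ₑ = 2 := by simp [Real.enorm_eq_ofReal]
          rw [this]
          push_cast
          rw [mul_assoc]
          gcongr
        · intro t ht
          have ht2 : {x | 2 * t < G x} ⊆ {x | ENNReal.ofReal t <
              MM (({y | ENNReal.ofReal t < h' y}).indicator h') x} := by
            intro x hx
            refine MM_trunc h' _ x ?_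
            have hx' : 2 * t < (MM h' x).toReal := hx
            rw [← ENNReal.ofReal_lt_iff_lt_toReal (by positivity) (hMfin x), ENNReal.ofReal_mul (by norm_num)] at hx'
            simpa using hx'
          have hset : {y | ENNReal.ofReal t < h' y} = {y | t < h y} := by
            ext y
            simp only [hh', mem_ofPred_eq]
            exact ENNReal.ofReal_lt_ofReal_iff_of_nonneg ht.le
          have hms : MeasurableSet {y | t < h y} := measurableSet_lt measurable_const hc.measurable
          have hintg : ∫⁻ y, ({y | t < h y}).indicator h' y = ∫⁻ y in {y | t < h y}, ENNReal.ofReal (h y) :=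
            lintegral_indicator hms _
          rw [hset] at ht2
          rw [← hintg]
          refine le_trans (mul_le_mul_right (measure_mono ht2) _) (weak_MM _ ?_ _ (by simpa using ht) ENNReal.ofReal_ne_top)
          rw [hintg]
          refine ne_top_of_le_ne_top ?_ (setLIntegral_le_lintegral _ _)
          exact (hi.lintegral_lt_top).ne
    have hsum : eLpNorm (fun x => h x + G x) q volume ≤ (1 + 2 * K : ℝ≥0) * eLpNorm h q volume := by
      refine (eLpNorm_add_le hc.aestronglyMeasurable hGm.aestronglyMeasurable hq1).trans ?_
      rw [ENNReal.coe_add, add_mul]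
      gcongr
      simp
    have h5 : (fun x => 8 * (h x + G x)) = (8:ℝ) • (fun x => h x + G x) := by
      ext x; simp
    rw [h5, eLpNorm_const_smul]
    have : ‖(8:ℝ)‖ₑ = 8 := by simp [Real.enorm_eq_ofReal]
    rw [this, ENNReal.coe_mul, mul_assoc]
    gcongr
    norm_num

/-! ### Words of partial derivatives of Schwartz functions -/

/-- partial derivative -/
def pd (i : Fin 3) (f : SchwartzMap V3 ℝ) : SchwartzMap V3 ℝ := LineDeriv.lineDerivOp (e3 i) f

/-- iterated partial derivatives along a word -/
def DL : List (Fin 3) → SchwartzMap V3 ℝ → SchwartzMap V3 ℝ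
  | [], f => f
  | i :: l, f => pd i (DL l f)

lemma pd_apply (i : Fin 3) (f : SchwartzMap V3 ℝ) (x : V3) :
    pd i f x = fderiv ℝ f x (e3 i) := SchwartzMap.lineDerivOp_apply_eq_fderiv _ _ _

lemma DL_append (a : List (Fin 3)) (i : Fin 3) (f : SchwartzMap V3 ℝ) :
    DL (a ++ [i]) f = DL a (pd i f) := by
  induction a with
  | nil => rfl
  | cons j a ih => simp only [List.cons_append, DL, ih]

lemma DL_append' (a b : List (Fin 3)) (f : SchwartzMap V3 ℝ) :
    DL (a ++ b) f = DL a (DL b f) := by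
  induction a with
  | nil => rfl
  | cons j a ih => simp only [List.cons_append, DL, ih]

lemma DL_ofFn (n : ℕ) (d : Fin n → Fin 3) (f : SchwartzMap V3 ℝ) :
    DL (List.ofFn d) f = LineDeriv.iteratedLineDerivOp (fun i => e3 (d i)) f := by
  induction n with
  | zero => simp [DL]
  | succ n ih =>
    rw [List.ofFn_succ, DL, ih, LineDeriv.iteratedLineDerivOp_succ_left]
    rfl

lemma DL_ofFn_apply (n : ℕ) (d : Fin n → Fin 3) (f : SchwartzMap V3 ℝ) (x : V3) :
    DL (List.ofFn d) f x = Dmix n d f x := by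
  rw [DL_ofFn, SchwartzMap.iteratedLineDerivOp_eq_iteratedFDeriv]; rfl

lemma norm_e3 (i : Fin 3) : ‖e3 i‖ = 1 := by
  have := Pi.norm_single (G := fun _ : Fin 3 => ℝ) (i := i) (1 : ℝ)
  simpa [e3] using this

lemma abs_DL_le (l : List (Fin 3)) (n : ℕ) (hn : l.length = n) (f : SchwartzMap V3 ℝ) (x : V3) :
    |DL l f x| ≤ ‖iteratedFDeriv ℝ n f x‖ := by
  subst hn
  have h := DL_ofFn_apply l.length l.get f x
  rw [List.ofFn_get] at h
  rw [h, Dmix, ← Real.norm_eq_abs]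
  refine (ContinuousMultilinearMap.le_opNorm _ _).trans ?_
  simp [norm_e3]

/-- product of Schwartz functions -/
def mulS (f g : SchwartzMap V3 ℝ) : SchwartzMap V3 ℝ := SchwartzMap.smulLeftCLM ℝ (⇑f) g

lemma mulS_apply (f g : SchwartzMap V3 ℝ) (x : V3) : mulS f g x = f x * g x := by
  rw [mulS, SchwartzMap.smulLeftCLM_apply_apply f.hasTemperateGrowth]; rfl

lemma coe_mulS (f g : SchwartzMap V3 ℝ) : ⇑(mulS f g) = fun x => f x * g x :=
  funext (mulS_apply f g)

lemma pd_add (i : Fin 3) (f g : SchwartzMap V3 ℝ) : pd i (f + g) = pd i f + pd i g :=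
  LineDeriv.lineDerivOp_add _ _ _

lemma pd_mulS (i : Fin 3) (f g : SchwartzMap V3 ℝ) :
    pd i (mulS f g) = mulS (pd i f) g + mulS f (pd i g) := by
  ext x
  rw [add_apply, pd_apply, mulS_apply, mulS_apply, coe_mulS,
    fderiv_fun_mul f.differentiableAt g.differentiableAt, pd_apply, pd_apply]
  simp
  ring

lemma pd_sum (i : Fin 3) (L : List (SchwartzMap V3 ℝ)) : pd i L.sum = (L.map (pd i)).sum := by
  induction L with
  | nil => ext x; simp [pd_apply]
  | cons a L ih => simp [pd_add, ih]

lemma sum_map_add' {β : Type*} (L : List β) (u v : β → SchwartzMap V3 ℝ) :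
    (L.map (fun a => u a + v a)).sum = (L.map u).sum + (L.map v).sum := by
  induction L with
  | nil => simp
  | cons a L ih => simp only [List.map_cons, List.sum_cons, ih]; abel

lemma leib (l : List (Fin 3)) : ∃ L : List (List (Fin 3) × List (Fin 3)),
    (∀ ab ∈ L, ab.1 ≠ [] ∧ ab.1.length + ab.2.length = l.length) ∧
    ∀ f g, DL l (mulS f g) = mulS f (DL l g) +
      (L.map fun ab => mulS (DL ab.1 f) (DL ab.2 g)).sum := by
  induction l with
  | nil => exact ⟨[], by simp, fun f g => by simp [DL]⟩
  | cons i l ih =>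
    obtain ⟨L, h1, h2⟩ := ih
    refine ⟨([i], l) :: (L.map (fun ab => (i :: ab.1, ab.2)) ++ L.map (fun ab => (ab.1, i :: ab.2))),
      ?_, fun f g => ?_⟩
    · intro ab hab
      simp only [List.mem_cons, List.mem_append, List.mem_map] at hab
      rcases hab with rfl | ⟨c, hc, rfl⟩ | ⟨c, hc, rfl⟩
      · simp; omega
      · have := (h1 c hc).2
        simp; omega
      · have := h1 c hc
        refine ⟨this.1, ?_⟩
        simp; omega
    · simp only [DL]
      rw [h2, pd_add, pd_mulS, pd_sum, List.map_cons, List.sum_cons, List.map_append,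
        List.sum_append, List.map_map, List.map_map, List.map_map]
      have : (pd i ∘ fun ab : List (Fin 3) × List (Fin 3) => mulS (DL ab.1 f) (DL ab.2 g)) =
          fun ab => mulS (DL (i :: ab.1) f) (DL ab.2 g) + mulS (DL ab.1 f) (DL (i :: ab.2) g) := by
        ext1 ab
        simp [pd_mulS, DL]
      rw [this, sum_map_add']
      simp only [Function.comp_def, DL]
      abel

lemma schwartz_bdd (f : SchwartzMap V3 ℝ) : ∃ K, 0 ≤ K ∧ ∀ x, |f x| ≤ K := by
  obtain ⟨C, hC⟩ := f.decay 0 0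
  refine ⟨C, hC.1.le, fun x => ?_⟩
  simpa using hC.2 x

/-! ### Weighted averages and pointwise interpolation -/

/-- weighted average at scale `s` -/
def AA (φ : V3 → ℝ) (w : SchwartzMap V3 ℝ) (x : V3) (s : ℝ) : ℝ := ∫ y, φ y * w (x + s • y)

/-- admissible weights -/
structure Adm (φ : V3 → ℝ) (K : ℝ) : Prop where
  cont : Continuous φ
  bdd : ∀ y, |φ y| ≤ K
  supp : ∀ y, y ∉ Metric.closedBall (0 : V3) 1 → φ y = 0

lemma Adm.nonneg {φ : V3 → ℝ} {K : ℝ} (h : Adm φ K) : 0 ≤ K := (abs_nonneg _).trans (h.bdd 0)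

lemma Adm.integrable {φ : V3 → ℝ} {K : ℝ} (h : Adm φ K) (u : V3 → ℝ) (hu : Continuous u) :
    Integrable (fun y => φ y * u y) := by
  refine (h.cont.mul hu).integrable_of_hasCompactSupport ?_
  refine HasCompactSupport.intro (isCompact_closedBall (0 : V3) 1) fun y hy => ?_
  simp [h.supp y hy]

lemma coord_le {y : V3} (hy : y ∈ Metric.closedBall (0 : V3) 1) (i : Fin 3) : |y i| ≤ 1 := by
  have h1 : ‖y‖ ≤ 1 := by simpa using hy
  exact (norm_le_pi_norm y i).trans h1

lemma Adm.coord {φ : V3 → ℝ} {K : ℝ} (h : Adm φ K) (i : Fin 3) : Adm (fun y => φ y * y i) K where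
  cont := h.cont.mul (continuous_apply i)
  bdd := fun y => by
    by_cases hy : y ∈ Metric.closedBall (0 : V3) 1
    · rw [abs_mul]
      calc |φ y| * |y i| ≤ K * 1 :=
            mul_le_mul (h.bdd y) (coord_le hy i) (abs_nonneg _) h.nonneg
        _ = K := mul_one K
    · simp [h.supp y hy, h.nonneg]
  supp := fun y hy => by simp [h.supp y hy]

lemma abs_AA_le {φ : V3 → ℝ} {K : ℝ} (h : Adm φ K) (w : SchwartzMap V3 ℝ) (x : V3) (s N : ℝ)
    (hN : ∫ y in Metric.closedBall (0 : V3) 1, |w (x + s • y)| ≤ N) : |AA φ w x s| ≤ K * N := by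
  have hwc := w.continuous
  have e : AA φ w x s = ∫ y in Metric.closedBall (0 : V3) 1, φ y * w (x + s • y) := by
    rw [AA, setIntegral_eq_integral_of_forall_compl_eq_zero]
    intro y hy
    simp [h.supp y hy]
  rw [e, ← Real.norm_eq_abs]
  refine (norm_integral_le_integral_norm _).trans ?_
  calc ∫ y in Metric.closedBall (0 : V3) 1, ‖φ y * w (x + s • y)‖
      ≤ ∫ y in Metric.closedBall (0 : V3) 1, K * |w (x + s • y)| := by
        refine setIntegral_mono ?_ ?_ fun y => ?_
        · exact (h.integrable _ (by fun_prop)).norm.integrableOn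
        · exact (Continuous.continuousOn (by fun_prop)).integrableOn_compact
            (isCompact_closedBall _ _)
        · simp only [norm_mul, Real.norm_eq_abs]
          exact mul_le_mul_of_nonneg_right (h.bdd y) (abs_nonneg _)
    _ = K * ∫ y in Metric.closedBall (0 : V3) 1, |w (x + s • y)| := integral_const_mul _ _
    _ ≤ K * N := mul_le_mul_of_nonneg_left hN h.nonneg

lemma fderiv_eq_sum (w : SchwartzMap V3 ℝ) (z y : V3) :
    fderiv ℝ w z y = ∑ i, y i * pd i w z := by
  have : y = ∑ i, y i • e3 i := by
    ext j; simp [e3, Finset.sum_apply, Pi.single_apply]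
  conv_lhs => rw [this]
  rw [map_sum]
  simp [pd_apply]

lemma hasDerivAt_AA {φ : V3 → ℝ} {K : ℝ} (h : Adm φ K) (w : SchwartzMap V3 ℝ) (x : V3) (s : ℝ) :
    HasDerivAt (AA φ w x) ((∑ i, AA (fun y => φ y * y i) (pd i w) x) s) s := by
  have hwc := w.continuous
  have hb : ∀ i, ∃ B, 0 ≤ B ∧ ∀ z, |pd i w z| ≤ B := fun i => schwartz_bdd (pd i w)
  choose B hB0 hB using hb
  have hpc : ∀ i, Continuous (pd i w) := fun i => (pd i w).continuous
  set F' : ℝ → V3 → ℝ := fun s y => ∑ i, φ y * y i * pd i w (x + s • y) with hF'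
  have := (hasDerivAt_integral_of_dominated_loc_of_deriv_le (μ := (volume : Measure V3)) (𝕜 := ℝ)
    (F := fun s y => φ y * w (x + s • y)) (F' := F') (x₀ := s) (s := univ)
    (bound := (Metric.closedBall (0 : V3) 1).indicator fun _ => ∑ i, K * B i)
    Filter.univ_mem ?_ ?_ ?_ ?_ ?_ ?_).2
  · refine HasDerivAt.congr_deriv this ?_
    rw [hF', Finset.sum_apply, integral_finsetSum]
    · rfl
    · intro i _
      exact (h.coord i).integrable _ (by fun_prop)
  · refine Filter.Eventually.of_forall fun s => ?_
    exact (h.cont.mul (by fun_prop)).aestronglyMeasurable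
  · exact h.integrable _ (by fun_prop)
  · refine Continuous.aestronglyMeasurable ?_
    have := h.cont
    fun_prop
  · refine Filter.Eventually.of_forall fun y s _ => ?_
    by_cases hy : y ∈ Metric.closedBall (0 : V3) 1
    · rw [indicator_of_mem hy, hF']
      refine (norm_sum_le _ _).trans (Finset.sum_le_sum fun i _ => ?_)
      rw [norm_mul]
      exact mul_le_mul ((h.coord i).bdd y) (hB i _) (norm_nonneg _) h.nonneg
    · rw [indicator_of_notMem hy, hF']
      simp [h.supp y hy]
  · refine (integrable_indicator_iff Metric.isClosed_closedBall.measurableSet).2 ?_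
    exact integrableOn_const (vol_cb_ne_top _ _)
  · refine Filter.Eventually.of_forall fun y s _ => ?_
    have h1 : HasDerivAt (fun s : ℝ => x + s • y) y s := by
      simpa using ((hasDerivAt_id s).smul_const y).const_add x
    have h2 := ((w.hasFDerivAt (x + s • y)).comp_hasDerivAt s h1).const_mul (φ y)
    refine HasDerivAt.congr_deriv h2 ?_
    rw [fderiv_eq_sum, hF', Finset.mul_sum]
    exact Finset.sum_congr rfl fun i _ => by ring

lemma hasDerivAt_fwdDiff (t : ℝ) (m : ℕ) (F F' : ℝ → ℝ) (h : ∀ s, HasDerivAt F (F' s) s) (s : ℝ) :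
    HasDerivAt ((fwdDiff t)^[m] F) ((fwdDiff t)^[m] F' s) s := by
  induction m generalizing F F' with
  | zero => exact h s
  | succ m ih =>
    simp only [Function.iterate_succ_apply]
    refine ih _ _ fun s => ?_
    exact HasDerivAt.sub (HasDerivAt.comp_add_const s t (h (s + t))) (h s)

lemma fwdDiff_AA_le (x : V3) (t : ℝ) (ht : 0 < t) (m : ℕ) (φ : V3 → ℝ) (K N : ℝ) (h : Adm φ K)
    (w : SchwartzMap V3 ℝ)
    (hN : ∀ l : List (Fin 3), l.length = m → ∀ s : ℝ,
      ∫ y in Metric.closedBall (0 : V3) 1, |DL l w (x + s • y)| ≤ N) (s : ℝ) :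
    |(fwdDiff t)^[m] (AA φ w x) s| ≤ (3 * t) ^ m * (K * N) := by
  induction m generalizing φ w s with
  | zero =>
    simp only [Function.iterate_zero, id_eq, pow_zero, one_mul]
    exact abs_AA_le h w x s N (hN [] rfl s)
  | succ m ih =>
    rw [Function.iterate_succ_apply']
    have hd := hasDerivAt_fwdDiff t m _ _ (fun s => hasDerivAt_AA h w x s)
    have hbd : ∀ r, ‖(fwdDiff t)^[m] (∑ i, AA (fun y => φ y * y i) (pd i w) x) r‖ ≤
        3 * ((3 * t) ^ m * (K * N)) := by
      intro r
      rw [fwdDiff_iter_finsetSum, Finset.sum_apply]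
      refine (norm_sum_le _ _).trans ?_
      refine (Finset.sum_le_sum (g := fun _ => (3 * t) ^ m * (K * N)) fun i _ => ?_).trans ?_
      · refine ih _ (h.coord i) (pd i w) (fun l hl s => ?_) r
        rw [← DL_append]
        exact hN _ (by simp [hl]) s
      · simp
    have hmv := (convex_univ (𝕜 := ℝ) (E := ℝ)).norm_image_sub_le_of_norm_hasDerivWithin_le
      (f := (fwdDiff t)^[m] (AA φ w x)) (fun r _ => (hd r).hasDerivWithinAt) (fun r _ => hbd r)
      (mem_univ s) (mem_univ (s + t))
    rw [fwdDiff, ← Real.norm_eq_abs]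
    refine hmv.trans (le_of_eq ?_)
    rw [add_sub_cancel_left, Real.norm_eq_abs, abs_of_pos ht]
    ring

lemma adm_of_schwartz (φ : SchwartzMap V3 ℝ) (h : tsupport φ ⊆ Metric.closedBall (0 : V3) 1) :
    ∃ K, Adm φ K := by
  obtain ⟨K, _, hK⟩ := schwartz_bdd φ
  exact ⟨K, φ.continuous, hK, fun y hy => image_eq_zero_of_notMem_tsupport fun h' => hy (h h')⟩

lemma ibp_one (φ : SchwartzMap V3 ℝ) (h : tsupport φ ⊆ Metric.closedBall (0 : V3) 1) (i : Fin 3)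
    (f : SchwartzMap V3 ℝ) (x : V3) (s : ℝ) :
    s * AA φ (pd i f) x s = AA (-pd i φ) f x s := by
  obtain ⟨K, hK⟩ := adm_of_schwartz φ h
  obtain ⟨K', hK'⟩ := adm_of_schwartz (pd i φ)
    ((SchwartzMap.tsupport_lineDerivOp_subset _ _).trans h)
  have hfc := f.continuous
  have hpc := (pd i f).continuous
  have hd : ∀ y, HasFDerivAt (fun y => f (x + s • y)) (s • fderiv ℝ f (x + s • y)) y := by
    intro y
    have h1 : HasFDerivAt (fun y : V3 => x + s • y) (s • ContinuousLinearMap.id ℝ V3) y :=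
      ((hasFDerivAt_id y).const_smul s).const_add x
    have h2 := (f.hasFDerivAt (x + s • y)).comp y h1
    refine HasFDerivAt.congr_fderiv h2 ?_
    ext v; simp
  have hfd : ∀ y, fderiv ℝ (fun y => f (x + s • y)) y (e3 i) = s * pd i f (x + s • y) := by
    intro y; rw [(hd y).fderiv, pd_apply]; simp
  have key := integral_mul_fderiv_eq_neg_fderiv_mul_of_integrable (μ := (volume : Measure V3))
    (f := φ) (g := fun y => f (x + s • y)) (v := e3 i) ?_ ?_ ?_ ?_ ?_
  · simp only [hfd, ← pd_apply] at key
    unfold AA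
    rw [← integral_const_mul]
    have e1 : ∀ y, s * (φ y * pd i f (x + s • y)) = φ y * (s * pd i f (x + s • y)) := fun y => by ring
    simp only [e1, key, Pi.neg_apply, neg_mul, integral_neg]
  · simp only [← pd_apply]
    exact hK'.integrable _ (by fun_prop)
  · simp only [hfd]
    exact hK.integrable _ (by fun_prop)
  · exact hK.integrable _ (by fun_prop)
  · exact fun y _ => φ.differentiableAt
  · exact fun y _ => (hd y).differentiableAt

lemma ibp (a : List (Fin 3)) (φ : SchwartzMap V3 ℝ)
    (h : tsupport φ ⊆ Metric.closedBall (0 : V3) 1) :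
    ∃ ψ : SchwartzMap V3 ℝ, tsupport ψ ⊆ Metric.closedBall (0 : V3) 1 ∧
      ∀ (f : SchwartzMap V3 ℝ) (x : V3) (s : ℝ), s ^ a.length * AA φ (DL a f) x s = AA ψ f x s := by
  induction a generalizing φ with
  | nil => exact ⟨φ, h, fun f x s => by simp [DL]⟩
  | cons i a ih =>
    have h' : tsupport (-pd i φ) ⊆ Metric.closedBall (0 : V3) 1 := by
      have : tsupport (⇑(-pd i φ)) = tsupport (⇑(pd i φ)) := by
        have e : (⇑(-pd i φ) : V3 → ℝ) = -⇑(pd i φ) := by ext; simp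
        rw [e, tsupport, tsupport, Function.support_neg]
      rw [this]
      exact (SchwartzMap.tsupport_lineDerivOp_subset _ _).trans h
    obtain ⟨ψ, h1, h2⟩ := ih (-pd i φ) h'
    refine ⟨ψ, h1, fun f x s => ?_⟩
    rw [← h2, DL, List.length_cons, pow_succ, mul_assoc, ibp_one φ h]
    rfl

lemma exists_bump : ∃ φ : SchwartzMap V3 ℝ, tsupport φ ⊆ Metric.closedBall (0 : V3) 1 ∧
    ∫ y, φ y = 1 := by
  let b : ContDiffBump (0 : V3) := ⟨1 / 2, 1, by norm_num, by norm_num⟩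
  have hcs : HasCompactSupport (b.normed volume) := b.hasCompactSupport_normed
  refine ⟨hcs.toSchwartzMap b.contDiff_normed, ?_, ?_⟩
  · exact b.tsupport_normed_eq.subset
  · exact b.integral_normed

lemma interp (a : List (Fin 3)) (n : ℕ) (han : a.length ≤ n) : ∃ C : ℝ, 0 ≤ C ∧
    ∀ (F : SchwartzMap V3 ℝ) (x : V3) (A B : ℝ),
      (∀ s : ℝ, ∫ y in Metric.closedBall (0 : V3) 1, |F (x + s • y)| ≤ A) →
      (∀ l : List (Fin 3), l.length = n → ∀ s : ℝ,
        ∫ y in Metric.closedBall (0 : V3) 1, |DL l F (x + s • y)| ≤ B) →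
      ∀ t : ℝ, 0 < t →
        |DL a F x| ≤ C * ((t ^ a.length)⁻¹ * A + t ^ (n - a.length) * B) := by
  obtain ⟨φ, hφ, hφ1⟩ := exists_bump
  obtain ⟨ψ, hψ, hib⟩ := ibp a φ hφ
  obtain ⟨K, hK⟩ := adm_of_schwartz φ hφ
  obtain ⟨K', hK'⟩ := adm_of_schwartz ψ hψ
  set m := n - a.length with hm
  set S : ℝ := ∑ i ∈ Finset.range m, (m.choose (i + 1) : ℝ) with hS
  have hS0 : 0 ≤ S := Finset.sum_nonneg fun i _ => by positivity
  have hK0 := hK.nonneg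
  have hK0' := hK'.nonneg
  refine ⟨3 ^ m * K + S * K', by positivity, fun F x A B hA hB t ht => ?_⟩
  have hA0 : 0 ≤ A := le_trans (integral_nonneg fun y => abs_nonneg _) (hA 0)
  have hB0 : 0 ≤ B := le_trans (integral_nonneg fun y => abs_nonneg _)
    (hB (List.replicate n 0) (by simp) 0)
  have h1 := fwdDiff_AA_le x t ht m φ K B hK (DL a F) (fun l hl s => by
    rw [← DL_append']
    exact hB _ (by simp [hl]; omega) s) 0
  rw [fwdDiff_iter_eq_sum_shift, Finset.sum_range_succ'] at h1
  have h2 : AA φ (DL a F) x (0 + 0 • t) = DL a F x := by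
    simp [AA, integral_mul_const, hφ1]
  rw [h2] at h1
  set R := ∑ i ∈ Finset.range m, ((-1 : ℤ) ^ (m - (i + 1)) * (m.choose (i + 1) : ℤ)) •
    AA φ (DL a F) x (0 + (i + 1) • t) with hR
  have h3 : |R| ≤ S * (K' * A * (t ^ a.length)⁻¹) := by
    rw [hR, hS, Finset.sum_mul]
    refine (Finset.abs_sum_le_sum_abs _ _).trans (Finset.sum_le_sum fun i _ => ?_)
    rw [zsmul_eq_mul, abs_mul]
    have e1 : |(((-1 : ℤ) ^ (m - (i + 1)) * (m.choose (i + 1) : ℤ) : ℤ) : ℝ)| = m.choose (i + 1) := by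
      push_cast
      rw [abs_mul, abs_pow]; simp
    rw [e1]
    refine mul_le_mul_of_nonneg_left ?_ (by positivity)
    set s : ℝ := 0 + (i + 1) • t with hs
    have hst : t ≤ s := by
      rw [hs, nsmul_eq_mul]; push_cast
      nlinarith [(Nat.cast_nonneg i : (0:ℝ) ≤ i)]
    have hs0 : 0 < s := ht.trans_le hst
    have e2 := abs_AA_le hK' F x s A (hA s)
    rw [← hib, abs_mul, abs_of_pos (pow_pos hs0 _)] at e2
    rw [← div_eq_mul_inv, le_div_iff₀ (by positivity), mul_comm]
    refine le_trans ?_ e2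
    gcongr
  have h4 : |DL a F x| ≤ (3 * t) ^ m * (K * B) + |R| := by
    have e3 : |(((-1 : ℤ) ^ (m - 0) * (m.choose 0 : ℤ)) • DL a F x)| = |DL a F x| := by
      rw [zsmul_eq_mul, abs_mul]; push_cast; simp
    rw [← e3]
    calc _ = |(R + ((-1 : ℤ) ^ (m - 0) * (m.choose 0 : ℤ)) • DL a F x) - R| := by
          rw [add_sub_cancel_left]
      _ ≤ |R + ((-1 : ℤ) ^ (m - 0) * (m.choose 0 : ℤ)) • DL a F x| + |R| := abs_sub _ _
      _ ≤ _ := by gcongr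
  have h5 : 0 ≤ 3 ^ m * K * ((t ^ a.length)⁻¹ * A) := by positivity
  have h6 : 0 ≤ S * K' * (t ^ m * B) := by positivity
  rw [mul_pow] at h4
  nlinarith

lemma product_interp (a b : List (Fin 3)) (n : ℕ) (hn : 1 ≤ n) (hab : a.length + b.length = n) :
    ∃ C : ℝ, 0 ≤ C ∧
    ∀ (F G : SchwartzMap V3 ℝ) (x : V3) (A B A' B' : ℝ),
      (∀ s : ℝ, ∫ y in Metric.closedBall (0 : V3) 1, |F (x + s • y)| ≤ A) →
      (∀ l : List (Fin 3), l.length = n → ∀ s : ℝ,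
        ∫ y in Metric.closedBall (0 : V3) 1, |DL l F (x + s • y)| ≤ B) →
      (∀ s : ℝ, ∫ y in Metric.closedBall (0 : V3) 1, |G (x + s • y)| ≤ A') →
      (∀ l : List (Fin 3), l.length = n → ∀ s : ℝ,
        ∫ y in Metric.closedBall (0 : V3) 1, |DL l G (x + s • y)| ≤ B') →
      |DL a F x * DL b G x| ≤ C * (A * B' + B * A') := by
  obtain ⟨C₁, hC₁, h₁⟩ := interp a n (by omega)
  obtain ⟨C₂, hC₂, h₂⟩ := interp b n (by omega)
  refine ⟨C₁ * C₂ * 2, by positivity, fun F G x A B A' B' hA hB hA' hB' => ?_⟩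
  have hA0 : 0 ≤ A := le_trans (integral_nonneg fun y => abs_nonneg _) (hA 0)
  have hB0 : 0 ≤ B := le_trans (integral_nonneg fun y => abs_nonneg _)
    (hB (List.replicate n 0) (by simp) 0)
  have hA0' : 0 ≤ A' := le_trans (integral_nonneg fun y => abs_nonneg _) (hA' 0)
  have hB0' : 0 ≤ B' := le_trans (integral_nonneg fun y => abs_nonneg _)
    (hB' (List.replicate n 0) (by simp) 0)
  have key : ∀ ε : ℝ, 0 < ε → |DL a F x * DL b G x| ≤
      C₁ * C₂ * 2 * ((A + ε) * B' + (B + ε) * A') := by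
    intro ε hε
    have hAε : 0 < A + ε := by linarith
    have hBε : 0 < B + ε := by linarith
    obtain ⟨t, ht, htn⟩ : ∃ t : ℝ, 0 < t ∧ t ^ n = (A + ε) / (B + ε) :=
      ⟨((A + ε) / (B + ε)) ^ ((n : ℝ)⁻¹), by positivity,
        Real.rpow_inv_natCast_pow (by positivity) (by omega)⟩
    have i1 := h₁ F x (A + ε) (B + ε) (fun s => (hA s).trans (by linarith))
      (fun l hl s => (hB l hl s).trans (by linarith)) t ht
    have i2 := h₂ G x A' B' hA' hB' t ht
    rw [show n - a.length = b.length by omega] at i1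
    rw [show n - b.length = a.length by omega] at i2
    rw [abs_mul]
    refine (mul_le_mul i1 i2 (abs_nonneg _) (by positivity)).trans (le_of_eq ?_)
    rw [← hab, pow_add] at htn
    set u := t ^ a.length with hu
    set v := t ^ b.length with hv
    have hu0 : 0 < u := by positivity
    have hv0 : 0 < v := by positivity
    rw [eq_div_iff hBε.ne'] at htn
    have e1 : (u⁻¹ * (A + ε) + v * (B + ε)) = 2 * (v * (B + ε)) := by
      rw [← htn]; field_simp; ring
    have e2 : v * (B + ε) * (v⁻¹ * A' + u * B') = (B + ε) * A' + (A + ε) * B' := by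
      rw [← htn]; field_simp
    calc _ = C₁ * C₂ * ((u⁻¹ * (A + ε) + v * (B + ε)) * (v⁻¹ * A' + u * B')) := by ring
      _ = C₁ * C₂ * 2 * (v * (B + ε) * (v⁻¹ * A' + u * B')) := by rw [e1]; ring
      _ = _ := by rw [e2]; ring
  have hlim : Filter.Tendsto (fun ε : ℝ => C₁ * C₂ * 2 * ((A + ε) * B' + (B + ε) * A'))
      (nhdsWithin 0 (Ioi 0)) (nhds (C₁ * C₂ * 2 * ((A + 0) * B' + (B + 0) * A'))) :=
    (Continuous.tendsto (by fun_prop) 0).mono_left nhdsWithin_le_nhds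
  simp only [add_zero] at hlim
  refine ge_of_tendsto hlim ?_
  filter_upwards [self_mem_nhdsWithin] with ε hε using key ε hε

/-! ### Pointwise product and commutator bounds -/

lemma list_bound {β Z : Type*} (L : List β) (T : β → Z → ℝ) (P : Z → Prop) (Q : Z → ℝ)
    (h : ∀ b ∈ L, ∃ C : ℝ, 0 ≤ C ∧ ∀ z, P z → |T b z| ≤ C * Q z) :
    ∃ C : ℝ, 0 ≤ C ∧ ∀ z, P z → |(L.map fun b => T b z).sum| ≤ C * Q z := by
  induction L with
  | nil => exact ⟨0, le_rfl, fun z _ => by simp⟩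
  | cons b L ih =>
    obtain ⟨C₁, h1, h1'⟩ := h b (by simp)
    obtain ⟨C₂, h2, h2'⟩ := ih fun c hc => h c (by simp [hc])
    refine ⟨C₁ + C₂, by positivity, fun z hz => ?_⟩
    rw [List.map_cons, List.sum_cons, add_mul]
    exact (abs_add_le _ _).trans (add_le_add (h1' z hz) (h2' z hz))

lemma list_sum_apply (L : List (SchwartzMap V3 ℝ)) (x : V3) :
    L.sum x = (L.map fun f => f x).sum := by
  induction L with
  | nil => simp
  | cons a L ih => simp [ih]

/-- `A` dominates, at `x`, all averages of the words of order `n` of `f`. -/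
def Dom (n : ℕ) (f : SchwartzMap V3 ℝ) (x : V3) (A : ℝ) : Prop :=
  ∀ l : List (Fin 3), l.length = n → ∀ s : ℝ,
    ∫ y in Metric.closedBall (0 : V3) 1, |DL l f (x + s • y)| ≤ A

lemma Dom.nonneg {n : ℕ} {f : SchwartzMap V3 ℝ} {x : V3} {A : ℝ} (h : Dom n f x A) : 0 ≤ A :=
  le_trans (integral_nonneg fun y => abs_nonneg _) (h (List.replicate n 0) (by simp) 0)

lemma Dom.point {n : ℕ} {f : SchwartzMap V3 ℝ} {x : V3} {A : ℝ} (h : Dom n f x A)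
    (l : List (Fin 3)) (hl : l.length = n) : |DL l f x| ≤ A := by
  have := h l hl 0
  simp only [zero_smul, add_zero, setIntegral_const, smul_eq_mul] at this
  rw [measureReal_def, Real.volume_pi_closedBall _ zero_le_one,
    ENNReal.toReal_ofReal (by positivity)] at this
  simp only [Fintype.card_fin] at this
  nlinarith [abs_nonneg (DL l f x)]

/-- parameters of the pointwise estimates -/
abbrev Par := SchwartzMap V3 ℝ × SchwartzMap V3 ℝ × V3 × ℝ × ℝ × ℝ × ℝ

lemma pw2 (l : List (Fin 3)) (k : ℕ) (hk : 1 ≤ k) (hl : l.length = k) :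
    ∃ C : ℝ, 0 ≤ C ∧ ∀ (f g : SchwartzMap V3 ℝ) (x : V3) (A B A' B' : ℝ),
      Dom 1 f x A → Dom k f x B → Dom 0 g x A' → Dom (k - 1) g x B' →
      |DL l (mulS f g) x - f x * DL l g x| ≤ C * (A * B' + B * A') := by
  obtain ⟨L, hL, hleib⟩ := leib l
  have := list_bound (Z := Par) L (fun ab z => DL ab.1 z.1 z.2.2.1 * DL ab.2 z.2.1 z.2.2.1)
    (fun z => Dom 1 z.1 z.2.2.1 z.2.2.2.1 ∧ Dom k z.1 z.2.2.1 z.2.2.2.2.1 ∧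
      Dom 0 z.2.1 z.2.2.1 z.2.2.2.2.2.1 ∧ Dom (k - 1) z.2.1 z.2.2.1 z.2.2.2.2.2.2)
    (fun z => z.2.2.2.1 * z.2.2.2.2.2.2 + z.2.2.2.2.1 * z.2.2.2.2.2.1) ?_
  · obtain ⟨C, hC, h⟩ := this
    refine ⟨C, hC, fun f g x A B A' B' h1 h2 h3 h4 => ?_⟩
    have h5 := h (f, g, x, A, B, A', B') ⟨h1, h2, h3, h4⟩
    rw [hleib, add_apply, mulS_apply, add_sub_cancel_left, list_sum_apply, List.map_map]
    simpa only [Function.comp_def, mulS_apply] using h5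
  · rintro ⟨a, b⟩ hab
    obtain ⟨ha, hlen⟩ := hL _ hab
    dsimp only at ha hlen
    obtain ⟨a', i, rfl⟩ := List.eq_nil_or_concat a |>.resolve_left ha
    simp only [List.concat_eq_append, List.length_append, List.length_cons, List.length_nil] at *
    by_cases hk1 : 1 ≤ k - 1
    · obtain ⟨C, hC, h⟩ := product_interp a' b (k - 1) hk1 (by omega)
      refine ⟨C, hC, ?_⟩
      rintro ⟨f, g, x, A, B, A', B'⟩ ⟨h1, h2, h3, h4⟩
      dsimp only at h1 h2 h3 h4 ⊢
      rw [DL_append]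
      refine h (pd i f) g x A B A' B' (fun s => h1 [i] rfl s) (fun m hm s => ?_)
        (fun s => h3 [] rfl s) h4
      rw [← DL_append]
      exact h2 _ (by simp; omega) s
    · refine ⟨1, zero_le_one, ?_⟩
      rintro ⟨f, g, x, A, B, A', B'⟩ ⟨h1, h2, h3, h4⟩
      dsimp only at h1 h2 h3 h4 ⊢
      have e1 := h2.point (a' ++ [i]) (by simp; omega)
      have e2 := h3.point b (by omega)
      rw [abs_mul]
      have e3 := mul_le_mul e1 e2 (abs_nonneg _) h2.nonneg
      have := mul_nonneg h1.nonneg h4.nonneg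
      linarith

lemma pw1 (l : List (Fin 3)) (k : ℕ) (hk : 1 ≤ k) (hl : l.length = k) :
    ∃ C : ℝ, 0 ≤ C ∧ ∀ (f g : SchwartzMap V3 ℝ) (x : V3) (A B A' B' : ℝ),
      Dom 0 f x A → Dom k f x B → Dom 0 g x A' → Dom k g x B' →
      |DL l (mulS f g) x| ≤ C * (A * B' + B * A') := by
  obtain ⟨L, hL, hleib⟩ := leib l
  have := list_bound (Z := Par) (([], l) :: L)
    (fun ab z => DL ab.1 z.1 z.2.2.1 * DL ab.2 z.2.1 z.2.2.1)
    (fun z => Dom 0 z.1 z.2.2.1 z.2.2.2.1 ∧ Dom k z.1 z.2.2.1 z.2.2.2.2.1 ∧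
      Dom 0 z.2.1 z.2.2.1 z.2.2.2.2.2.1 ∧ Dom k z.2.1 z.2.2.1 z.2.2.2.2.2.2)
    (fun z => z.2.2.2.1 * z.2.2.2.2.2.2 + z.2.2.2.2.1 * z.2.2.2.2.2.1) ?_
  · obtain ⟨C, hC, h⟩ := this
    refine ⟨C, hC, fun f g x A B A' B' h1 h2 h3 h4 => ?_⟩
    have h5 := h (f, g, x, A, B, A', B') ⟨h1, h2, h3, h4⟩
    rw [hleib, add_apply, mulS_apply, list_sum_apply, List.map_map]
    simpa only [Function.comp_def, mulS_apply, List.map_cons, List.sum_cons, DL] using h5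
  · rintro ⟨a, b⟩ hab
    have hlen : a.length + b.length = k := by
      rcases List.mem_cons.1 hab with h | h
      · cases h; simpa using hl
      · exact (hL _ h).2.trans hl
    obtain ⟨C, hC, h⟩ := product_interp a b k hk hlen
    refine ⟨C, hC, ?_⟩
    rintro ⟨f, g, x, A, B, A', B'⟩ ⟨h1, h2, h3, h4⟩
    exact h f g x A B A' B' (fun s => h1 [] rfl s) h2 (fun s => h3 [] rfl s) h4

/-! ### Conclusion -/

lemma exists_dom (p : ℝ≥0∞) (hp : 1 < p) (hp' : p ≠ ⊤) :
    ∃ C : ℝ≥0, ∀ (n : ℕ) (f : SchwartzMap V3 ℝ), ∃ H : V3 → ℝ, Measurable H ∧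
      (∀ x, Dom n f x (H x)) ∧
      ∀ q, p ≤ q → eLpNorm H q volume ≤ C * eLpNorm (iteratedFDeriv ℝ n f) q volume := by
  obtain ⟨C, hC⟩ := maximal p hp hp'
  refine ⟨C, fun n f => ?_⟩
  have hcont : Continuous (fun x => ‖iteratedFDeriv ℝ n f x‖) :=
    ((f.smooth n).continuous_iteratedFDeriv le_rfl).norm
  have hintg : Integrable (fun x => ‖iteratedFDeriv ℝ n f x‖) := by
    simpa using f.integrable_pow_mul_iteratedFDeriv volume 0 n
  have hbd : ∃ B, ∀ x, ‖iteratedFDeriv ℝ n f x‖ ≤ B := by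
    obtain ⟨K, hK⟩ := f.decay 0 n
    exact ⟨K, fun x => by simpa using hK.2 x⟩
  obtain ⟨H, h1, h2, h3, h4⟩ := hC (fun x => ‖iteratedFDeriv ℝ n f x‖) hcont
    (fun x => norm_nonneg _) hbd hintg
  · refine ⟨H, h1, fun x l hl s => le_trans ?_ (h3 x s), fun q hq => ?_⟩
    · have := (DL l f).continuous
      refine setIntegral_mono ?_ ?_ fun y => abs_DL_le l n hl f _
      · exact (Continuous.continuousOn (by fun_prop)).integrableOn_compact (isCompact_closedBall _ _)
      · exact (hcont.comp (by fun_prop)).continuousOn.integrableOn_compact (isCompact_closedBall _ _)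
    · have := h4 q hq
      rwa [eLpNorm_norm] at this

lemma final_step (p p₁ p₂ p₃ p₄ : ℝ≥0∞) (hp : 1 < p)
    (h12 : 1 / p = 1 / p₁ + 1 / p₂) (h34 : 1 / p = 1 / p₃ + 1 / p₄) (C D : ℝ≥0)
    (u A B A' B' : V3 → ℝ) (hA : Measurable A) (hB : Measurable B) (hA' : Measurable A')
    (hB' : Measurable B') (hu : ∀ x, |u x| ≤ C * (A x * B' x + B x * A' x))
    (NA NB NA' NB' : ℝ≥0∞)
    (iA : p ≤ p₁ → eLpNorm A p₁ volume ≤ D * NA)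
    (iB' : p ≤ p₂ → eLpNorm B' p₂ volume ≤ D * NB')
    (iB : p ≤ p₃ → eLpNorm B p₃ volume ≤ D * NB)
    (iA' : p ≤ p₄ → eLpNorm A' p₄ volume ≤ D * NA') :
    eLpNorm u p volume ≤ (C * (D * D) : ℝ≥0) * (NA * NB' + NB * NA') := by
  simp only [one_div] at h12 h34
  have l1 : p ≤ p₁ := ENNReal.inv_le_inv.1 (h12 ▸ le_self_add)
  have l2 : p ≤ p₂ := ENNReal.inv_le_inv.1 (h12 ▸ le_add_self)
  have l3 : p ≤ p₃ := ENNReal.inv_le_inv.1 (h34 ▸ le_self_add)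
  have l4 : p ≤ p₄ := ENNReal.inv_le_inv.1 (h34 ▸ le_add_self)
  have T1 : ENNReal.HolderTriple p₁ p₂ p := ⟨h12.symm⟩
  have T2 : ENNReal.HolderTriple p₃ p₄ p := ⟨h34.symm⟩
  have m1 : eLpNorm (A • B') p volume ≤ (D * NA) * (D * NB') :=
    (eLpNorm_smul_le_mul_eLpNorm hB'.aestronglyMeasurable hA.aestronglyMeasurable).trans
      (mul_le_mul' (iA l1) (iB' l2))
  have m2 : eLpNorm (B • A') p volume ≤ (D * NB) * (D * NA') :=
    (eLpNorm_smul_le_mul_eLpNorm hA'.aestronglyMeasurable hB.aestronglyMeasurable).trans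
      (mul_le_mul' (iB l3) (iA' l4))
  have m3 : eLpNorm u p volume ≤ eLpNorm ((C : ℝ) • (A • B' + B • A')) p volume :=
    eLpNorm_mono_real fun x => hu x
  refine m3.trans ?_
  rw [eLpNorm_const_smul]
  have hC : ‖(C : ℝ)‖ₑ = C := by simp
  rw [hC, ENNReal.coe_mul, ENNReal.coe_mul, mul_assoc]
  refine mul_le_mul_right ?_ _
  refine (eLpNorm_add_le (hA.mul hB').aestronglyMeasurable (hB.mul hA').aestronglyMeasurable
    hp.le).trans ((add_le_add m1 m2).trans (le_of_eq (by ring)))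

lemma eLpNorm_zeroth (f : SchwartzMap V3 ℝ) (q : ℝ≥0∞) :
    eLpNorm (iteratedFDeriv ℝ 0 f) q volume = eLpNorm f q volume :=
  eLpNorm_congr_norm_ae (Filter.Eventually.of_forall fun x => by simp)

/-- **Moser-type product and commutator estimates.**
Let `α` be a multi-index with `|α| = k ≥ 1` (encoded by the word `d` of its
directions) and `1 < p < ∞`.  There is `C > 0` such that for all Schwartz
functions `f, g` on `ℝ³` and all `1 ≤ p₁, p₂, p₃, p₄ ≤ ∞` with
`1/p = 1/p₁ + 1/p₂ = 1/p₃ + 1/p₄`: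
(i) `‖D^α(fg)‖_{L^p} ≤ C(‖f‖_{L^{p₁}}‖∇^k g‖_{L^{p₂}} + ‖∇^k f‖_{L^{p₃}}‖g‖_{L^{p₄}})`;
(ii) `‖[D^α, f]g‖_{L^p} ≤ C(‖∇f‖_{L^{p₁}}‖∇^{k−1} g‖_{L^{p₂}} + ‖∇^k f‖_{L^{p₃}}‖g‖_{L^{p₄}})`,
where `[D^α, f]g = D^α(fg) − f D^α g`. -/
theorem stmt_5 (k : ℕ) (hk : 1 ≤ k) (d : Fin k → Fin 3)
    (p : ℝ≥0∞) (hp : 1 < p) (hp' : p ≠ ⊤) :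
    ∃ C : ℝ≥0, 0 < C ∧
      ∀ (f g : SchwartzMap V3 ℝ) (p₁ p₂ p₃ p₄ : ℝ≥0∞),
        1 ≤ p₁ → 1 ≤ p₂ → 1 ≤ p₃ → 1 ≤ p₄ →
        1 / p = 1 / p₁ + 1 / p₂ → 1 / p = 1 / p₃ + 1 / p₄ →
        eLpNorm (Dmix k d (fun x => f x * g x)) p (volume : Measure V3) ≤
          (C : ℝ≥0∞) *
            (eLpNorm (⇑f) p₁ volume * eLpNorm (iteratedFDeriv ℝ k (⇑g)) p₂ volume +
              eLpNorm (iteratedFDeriv ℝ k (⇑f)) p₃ volume * eLpNorm (⇑g) p₄ volume) ∧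
        eLpNorm (fun x => Dmix k d (fun y => f y * g y) x - f x * Dmix k d (⇑g) x) p
            (volume : Measure V3) ≤
          (C : ℝ≥0∞) *
            (eLpNorm (iteratedFDeriv ℝ 1 (⇑f)) p₁ volume *
                eLpNorm (iteratedFDeriv ℝ (k - 1) (⇑g)) p₂ volume +
              eLpNorm (iteratedFDeriv ℝ k (⇑f)) p₃ volume * eLpNorm (⇑g) p₄ volume) := by
  obtain ⟨D, hD⟩ := exists_dom p hp hp'
  have hlen : (List.ofFn d).length = k := by simp
  obtain ⟨C₁, hC₁, h₁⟩ := pw1 (List.ofFn d) k hk hlen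
  obtain ⟨C₂, hC₂, h₂⟩ := pw2 (List.ofFn d) k hk hlen
  lift C₁ to ℝ≥0 using hC₁
  lift C₂ to ℝ≥0 using hC₂
  refine ⟨C₁ * (D * D) + C₂ * (D * D) + 1, by positivity, ?_⟩
  intro f g p₁ p₂ p₃ p₄ _ _ _ _ h12 h34
  obtain ⟨F0, mF0, dF0, nF0⟩ := hD 0 f
  obtain ⟨F1, mF1, dF1, nF1⟩ := hD 1 f
  obtain ⟨Fk, mFk, dFk, nFk⟩ := hD k f
  obtain ⟨G0, mG0, dG0, nG0⟩ := hD 0 g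
  obtain ⟨G1, mG1, dG1, nG1⟩ := hD (k - 1) g
  obtain ⟨Gk, mGk, dGk, nGk⟩ := hD k g
  simp only [eLpNorm_zeroth] at nF0 nG0
  have e : ∀ x, Dmix k d (fun x => f x * g x) x = DL (List.ofFn d) (mulS f g) x := fun x => by
    rw [DL_ofFn_apply, coe_mulS]
  constructor
  · refine (final_step p p₁ p₂ p₃ p₄ hp h12 h34 C₁ D _ F0 Fk G0 Gk mF0 mFk mG0 mGk (fun x => ?_)
      _ _ _ _ (nF0 p₁) (nGk p₂) (nFk p₃) (nG0 p₄)).trans ?_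
    · rw [e]
      exact h₁ f g x _ _ _ _ (dF0 x) (dFk x) (dG0 x) (dGk x)
    · gcongr
      rw [add_assoc]
      exact le_self_add
  · refine (final_step p p₁ p₂ p₃ p₄ hp h12 h34 C₂ D _ F1 Fk G0 G1 mF1 mFk mG0 mG1 (fun x => ?_)
      _ _ _ _ (nF1 p₁) (nG1 p₂) (nFk p₃) (nG0 p₄)).trans ?_
    · rw [e, ← DL_ofFn_apply]
      exact h₂ f g x _ _ _ _ (dF1 x) (dFk x) (dG0 x) (dG1 x)
    · gcongr
      rw [add_assoc, add_left_comm]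
      exact le_self_add
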